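/- Let α, β be real numbers with 0 < β < α and α² + β² = 1, and consider the cq-graph on input set Fin 2 with output space ℂ² given by the rank-one projections P₀ = [[α², αβ],[αβ, β²]] and P₁ = [[α², −αβ],[−αβ, β²]]. Let n ≥ 2 be an integer with αⁿ − βⁿ ≤ √((n−1)/n). Then the no-signalling assisted independence number of the n-fold product cq-graph satisfies Υ_n ≥ 1/(α^(2n) + β^(2n)), where Υ_n denotes Υ of the family of projections (P_{i⃗})_{i⃗ : Fin n → Fin 2} on ℂ^(Fin n → Fin 2) given entrywise by P_{i⃗} b b' = ∏_k P_{i⃗(k)} (b k) (b' k). -/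

import Mathlib

open Matrix BigOperators
open scoped ComplexOrder

noncomputable section

/-- Loewner order: `M ≤ N` iff `N - M` is positive semidefinite. -/
def loe {n : Type*} [Fintype n] (M N : Matrix n n ℂ) : Prop := (N - M).PosSemidef

/-- A projection: Hermitian and idempotent. -/
def IsProj {n : Type*} [Fintype n] (M : Matrix n n ℂ) : Prop := M.IsHermitian ∧ M * M = M

variable {I B : Type*} [Fintype I] [Fintype B] [DecidableEq B]

/-- No-signalling assisted independence number of a cq-graph. -/
def UpsilonCQ (P : I → Matrix B B ℂ) : ℝ :=
  sSup { x : ℝ | ∃ s : I → ℝ, (∀ i, 0 ≤ s i) ∧ x = ∑ i, s i ∧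
    ∃ R : I → Matrix B B ℂ,
      (∀ i, loe 0 (R i) ∧ loe (R i) (s i • ((1 : Matrix B B ℂ) - P i))) ∧
      ∑ i, (s i • P i + R i) = 1 }

/-- The `n`-fold product of a cq-graph. -/
def powCQ (P : I → Matrix B B ℂ) (n : ℕ) :
    (Fin n → I) → Matrix (Fin n → B) (Fin n → B) ℂ :=
  fun iv => Matrix.of fun b b' => ∏ k, P (iv k) (b k) (b' k)

lemma ups_bdd {I B : Type*} [Fintype I] [Fintype B] [DecidableEq B] (P : I → Matrix B B ℂ)
    (hP : ∀ i, (P i).trace = 1) :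
    BddAbove { x : ℝ | ∃ s : I → ℝ, (∀ i, 0 ≤ s i) ∧ x = ∑ i, s i ∧
    ∃ R : I → Matrix B B ℂ,
      (∀ i, loe 0 (R i) ∧ loe (R i) (s i • ((1 : Matrix B B ℂ) - P i))) ∧
      ∑ i, (s i • P i + R i) = 1 } := by
  refine ⟨(Fintype.card B : ℝ), ?_⟩
  rintro x ⟨s, hs, rfl, R, hR, hsum⟩
  have h := congrArg (fun M => (Matrix.trace M).re) hsum
  simp only [Matrix.trace_sum, Matrix.trace_add, Matrix.trace_smul, hP, Matrix.trace_one,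
    Complex.re_sum, Complex.add_re, Finset.sum_add_distrib] at h
  have h2 : 0 ≤ ∑ i, ((R i).trace).re := by
    refine Finset.sum_nonneg fun i _ => ?_
    have := (hR i).1
    unfold loe at this
    rw [sub_zero] at this
    exact (Complex.le_def.1 this.trace_nonneg).1
  simp at h
  linarith

lemma ups_ge {I B : Type*} [Fintype I] [Nonempty I] [Fintype B] [DecidableEq B]
    (P : I → Matrix B B ℂ) (χ : I → B → ℝ) (ψ : B → ℝ) (lam : ℝ) (hlam : 0 < lam)
    (hχ : ∀ i b, χ i b * χ i b = 1)
    (horth : ∀ b b', ∑ i, χ i b * χ i b' = if b = b' then (Fintype.card I : ℝ) else 0)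
    (hP : ∀ i b b', P i b b' = ((χ i b * ψ b : ℝ) : ℂ) * ((χ i b' * ψ b' : ℝ) : ℂ))
    (hψ : ∑ b, ψ b ^ 2 = 1)
    (T : Matrix B B ℂ) (hT : T.PosSemidef)
    (hT1 : (1 - Matrix.vecMulVec (fun b => (ψ b : ℂ)) (fun b => (ψ b : ℂ)) - T).PosSemidef)
    (hTd : ∀ b, T b b = ((lam - ψ b ^ 2 : ℝ) : ℂ)) :
    UpsilonCQ P ≥ 1 / lam := by
  have hI : (0 : ℝ) < Fintype.card I := by exact_mod_cast Fintype.card_pos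
  have htr : ∀ i, (P i).trace = 1 := by
    intro i
    simp only [Matrix.trace, Matrix.diag, hP]
    rw [← Complex.ofReal_one, ← hψ]
    push_cast
    refine Finset.sum_congr rfl fun b _ => ?_
    have : ((χ i b : ℂ)) * χ i b = 1 := by exact_mod_cast hχ i b
    linear_combination (ψ b : ℂ)^2 * this
  set s : ℝ := 1 / lam / Fintype.card I with hs
  have hs0 : 0 ≤ s := by positivity
  let D : I → Matrix B B ℂ := fun i => Matrix.diagonal (fun b => (χ i b : ℂ))
  have hDH : ∀ i, (D i)ᴴ = D i := by
    intro i
    simp only [D, Matrix.diagonal_conjTranspose]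
    congr 1
    ext b
    simp
  have hDD : ∀ i, D i * D i = 1 := by
    intro i
    simp only [D, Matrix.diagonal_mul_diagonal]
    rw [← Matrix.diagonal_one]
    congr 1
    ext b
    exact_mod_cast hχ i b
  have hPD : ∀ i, P i = D i * Matrix.vecMulVec (fun b => (ψ b : ℂ)) (fun b => (ψ b : ℂ)) * D i := by
    intro i
    ext b b'
    simp only [D, Matrix.mul_diagonal, Matrix.diagonal_mul, Matrix.vecMulVec_apply, hP]
    push_cast
    ring
  refine le_csSup (ups_bdd P htr) ⟨fun _ => s, fun _ => hs0, ?_, fun i => s • (D i * T * D i), ?_, ?_⟩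
  · simp [hs]
    field_simp
  · intro i
    constructor
    · unfold loe
      rw [sub_zero]
      have := hT.mul_mul_conjTranspose_same (D i)
      rw [hDH] at this
      exact this.smul hs0
    · unfold loe
      have := hT1.mul_mul_conjTranspose_same (D i)
      rw [hDH] at this
      have h2 := this.smul hs0
      convert h2 using 1
      rw [← smul_sub, hPD, Matrix.mul_sub, Matrix.mul_sub, Matrix.sub_mul, Matrix.sub_mul,
        Matrix.mul_one, hDD]
  · ext b b'
    rw [Matrix.sum_apply]
    have : ∀ i, (s • P i + s • (D i * T * D i)) b b' =
       ((χ i b * χ i b' : ℝ) : ℂ) * ((s : ℂ) * (ψ b * ψ b' + T b b')) := by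
      intro i
      simp only [D, Matrix.mul_diagonal, Matrix.diagonal_mul, Matrix.add_apply, Matrix.smul_apply, hP,
        Complex.real_smul]
      push_cast
      ring
    simp only [this]
    rw [← Finset.sum_mul, ← Complex.ofReal_sum, horth]
    by_cases h : b = b'
    · subst h
      simp only [if_true, Matrix.one_apply_eq, hTd, hs]
      norm_cast
      have := hI.ne'
      field_simp
      ring
    · simp [h]

lemma exT {B : Type*} [Fintype B] [DecidableEq B] (cls : B → ℕ) (ψ : B → ℝ) (u : B → ℂ) (c : B → ℝ)
    (hψc : ∀ b b', cls b = cls b' → ψ b = ψ b')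
    (huc : ∀ b b', cls b = cls b' → u b = u b')
    (hcc : ∀ b b', cls b = cls b' → c b = c b')
    (hc0 : ∀ b, 0 ≤ c b) (hc1 : ∀ b, c b ≤ 1)
    (hψ : ∑ b, ψ b ^ 2 = 1) (hu : ∑ b, star (u b) * u b = 1) (hψu : ∑ b, (ψ b : ℂ) * u b = 0) :
    ∃ T : Matrix B B ℂ, T.PosSemidef ∧
     (1 - Matrix.vecMulVec (fun b => (ψ b : ℂ)) (fun b => (ψ b : ℂ)) - T).PosSemidef ∧
     ∀ b, T b b = u b * star (u b) +
       (c b : ℂ) * (1 - 1 / ((Finset.univ.filter (fun b' => cls b' = cls b)).card : ℂ)) := by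
  let m : B → ℂ := fun b => ((Finset.univ.filter (fun b' => cls b' = cls b)).card : ℂ)
  have hm0 : ∀ b, m b ≠ 0 := by
    intro b
    simp only [m]
    norm_cast
    exact Finset.card_ne_zero_of_mem (a := b) (by simp)
  have hmc : ∀ b b', cls b = cls b' → m b = m b' := by
    intro b b' h
    simp only [m, h]
  have hmstar : ∀ b, star (m b) = m b := by
    intro b
    simp [m]
  let J : Matrix B B ℂ := Matrix.of fun b b' => if cls b' = cls b then (m b)⁻¹ else 0
  have hJv : ∀ v : B → ℂ, (∀ b b', cls b = cls b' → v b = v b') → J *ᵥ v = v := by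
    intro v hv
    ext b
    simp only [Matrix.mulVec, dotProduct, J, Matrix.of_apply, ite_mul, zero_mul]
    rw [← Finset.sum_filter]
    rw [Finset.sum_congr rfl (g := fun _ => (m b)⁻¹ * v b)]
    · rw [Finset.sum_const, nsmul_eq_mul]
      have := hm0 b
      change m b * _ = _
      field_simp
    · intro x hx
      rw [hv x b (by simpa using hx)]
  have hJH : Jᴴ = J := by
    ext b b'
    simp only [J, Matrix.conjTranspose_apply, Matrix.of_apply]
    by_cases h : cls b = cls b'
    · simp [h, hmc b b' h]
      simpa using hmstar b'
    · simp [h, Ne.symm h]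
  have hJJ : J * J = J := by
    ext b b'
    have := congrFun (hJv (fun x => J x b') (by
      intro x y h
      simp [J, h, hmc x y h])) b
    simpa [Matrix.mul_apply, Matrix.mulVec, dotProduct] using this
  have hvJ : ∀ v : B → ℂ, (∀ b b', cls b = cls b' → v b = v b') → (star v) ᵥ* J = star v := by
    intro v hv
    have := congrArg star (hJv v hv)
    rwa [Matrix.star_mulVec, hJH] at this
  let C : (B → ℝ) → Matrix B B ℂ := fun c => Matrix.diagonal (fun b => (c b : ℂ))
  let K : Matrix B B ℂ := 1 - J
  have hKH : Kᴴ = K := by simp [K, hJH]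
  have hKK : K * K = K := by
    simp [K, Matrix.mul_sub, Matrix.sub_mul, hJJ]
  have hCJ : C c * J = J * C c := by
    ext b b'
    simp only [C, J, Matrix.diagonal_mul, Matrix.mul_diagonal, Matrix.of_apply]
    by_cases h : cls b' = cls b
    · simp [h, hcc b' b h, mul_comm]
    · simp [h]
  have hKC : K * C c * K = C c * K := by
    have : K * C c = C c * K := by simp [K, Matrix.mul_sub, Matrix.sub_mul, hCJ]
    rw [this, Matrix.mul_assoc, hKK]
  let ψ' : B → ℂ := fun b => (ψ b : ℂ)
  have hsψ : star ψ' = ψ' := by ext b; simp [ψ']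
  have hψc' : ∀ b b', cls b = cls b' → ψ' b = ψ' b' := fun b b' h => by simp [ψ', hψc b b' h]
  have e1 : star ψ' ⬝ᵥ ψ' = 1 := by
    rw [hsψ]; simp only [dotProduct, ψ']; norm_cast; rw [← hψ]; simp [sq]
  have e2 : star u ⬝ᵥ u = 1 := by simpa [dotProduct] using hu
  have e3 : star ψ' ⬝ᵥ u = 0 := by rw [hsψ]; simpa [dotProduct, ψ'] using hψu
  have e4 : star u ⬝ᵥ ψ' = 0 := by
    have := congrArg star e3
    rw [← Matrix.star_dotProduct_star, star_star, star_zero, dotProduct_comm] at this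
    rw [dotProduct_comm] at this
    exact this
  let E : Matrix B B ℂ := J - Matrix.vecMulVec ψ' (star ψ') - Matrix.vecMulVec u (star u)
  have hEH : Eᴴ = E := by
    simp [E, hJH, Matrix.conjTranspose_vecMulVec]
  have hEE : E * E = E := by
    have a1 : ∀ x y : B → ℂ, (∀ b b', cls b = cls b' → x b = x b') →
        J * Matrix.vecMulVec x y = Matrix.vecMulVec x y := by
      intro x y hx
      rw [Matrix.mul_vecMulVec, hJv x hx]
    have a2 : ∀ x y : B → ℂ, (∀ b b', cls b = cls b' → y b = y b') →
        Matrix.vecMulVec x (star y) * J = Matrix.vecMulVec x (star y) := by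
      intro x y hy
      rw [Matrix.vecMulVec_mul, hvJ y hy]
    simp only [E, Matrix.mul_sub, Matrix.sub_mul, hJJ, a1 _ _ hψc', a1 _ _ huc, a2 _ _ hψc',
      a2 _ _ huc, Matrix.vecMulVec_mul_vecMulVec, e1, e2, e3, e4]
    simp
  have hCp : ∀ c : B → ℝ, (∀ b, 0 ≤ c b) → (K * C c * K).PosSemidef := by
    intro c hc
    have h : (C c).PosSemidef := Matrix.PosSemidef.diagonal (fun b => by simpa using hc b)
    have := h.mul_mul_conjTranspose_same K
    rwa [hKH] at this
  have hEp : E.PosSemidef := by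
    have := Matrix.posSemidef_conjTranspose_mul_self E
    rwa [hEH, hEE] at this
  refine ⟨Matrix.vecMulVec u (star u) + K * C c * K,
    (Matrix.posSemidef_vecMulVec_self_star u).add (hCp c hc0), ?_, ?_⟩
  · have := hEp.add (hCp (fun b => 1 - c b) (fun b => sub_nonneg.2 (hc1 b)))
    convert this using 1
    have h1 : C (fun b => 1 - c b) = 1 - C c := by
      simp only [C]
      rw [← Matrix.diagonal_one, Matrix.diagonal_sub]
      simp
    have h2 : K * (1 - C c) * K = K - K * C c * K := by
      rw [Matrix.mul_sub K 1 (C c), Matrix.sub_mul (K * 1), Matrix.mul_one, hKK]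
    rw [h1, h2]
    change 1 - Matrix.vecMulVec ψ' ψ' - _ = _
    simp only [E, hsψ, K]
    abel
  · intro b
    rw [hKC]
    simp [C, K, J, Matrix.vecMulVec_apply, Matrix.sub_apply, m]


def wtB {n : ℕ} (x : Fin n → Fin 2) : ℕ := (Finset.univ.filter (fun k => ¬ x k = 0)).card

lemma wtB_le {n : ℕ} (x : Fin n → Fin 2) : wtB x ≤ n := by
  unfold wtB
  exact (Finset.card_le_univ _).trans (by simp)

lemma wtB_zero {n : ℕ} (x : Fin n → Fin 2) :
    (Finset.univ.filter (fun k => x k = 0)).card = n - wtB x := by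
  have := Finset.card_filter_add_card_filter_not (s := (Finset.univ : Finset (Fin n))) (fun k => x k = 0)
  unfold wtB
  simp only [Finset.card_univ, Fintype.card_fin] at this
  omega

lemma prod_wtB {n : ℕ} (x : Fin n → Fin 2) (a b : ℝ) :
    ∏ k, (if x k = 0 then a else b) = a ^ (n - wtB x) * b ^ (wtB x) := by
  rw [Finset.prod_ite, Finset.prod_const, Finset.prod_const, wtB_zero]
  rfl

lemma sum_wtB (n : ℕ) (a b : ℝ) (h : a ^ 2 + b ^ 2 = 1) :
    ∑ x : Fin n → Fin 2, (a ^ (n - wtB x) * b ^ (wtB x)) ^ 2 = 1 := by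
  simp only [← prod_wtB, ← Finset.prod_pow]
  have := (Fintype.prod_sum (fun (_ : Fin n) (j : Fin 2) => (if j = 0 then a else b) ^ 2)).symm
  rw [this]
  simp [h]

lemma card_wtB (n w : ℕ) :
    (Finset.univ.filter (fun x : Fin n → Fin 2 => wtB x = w)).card = n.choose w := by
  have h : (Finset.powersetCard w (Finset.univ : Finset (Fin n))).card = n.choose w := by simp
  rw [← h]
  refine Finset.card_bij (fun x _ => Finset.univ.filter (fun k => ¬ x k = 0)) ?_ ?_ ?_
  · intro x hx
    simp only [Finset.mem_filter, Finset.mem_univ, true_and] at hx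
    simp only [Finset.mem_powersetCard, Finset.subset_univ, true_and]
    exact hx
  · intro x _ y _ hxy
    ext k
    have := Finset.ext_iff.1 hxy k
    simp only [Finset.mem_filter, Finset.mem_univ, true_and] at this
    have h1 := (x k).isLt
    have h2 := (y k).isLt
    simp only [Fin.ext_iff, Fin.val_zero] at this
    omega
  · intro s hs
    simp only [Finset.mem_powersetCard, Finset.subset_univ, true_and] at hs
    have e : Finset.univ.filter (fun k => ¬ (if k ∈ s then (1 : Fin 2) else 0) = 0) = s := by
      ext k
      by_cases hk : k ∈ s <;> simp [hk]
    refine ⟨fun k => if k ∈ s then 1 else 0, ?_, e⟩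
    simp only [Finset.mem_filter, Finset.mem_univ, true_and]
    unfold wtB
    rw [e, hs]

lemma choose_ge_self (n : ℕ) : ∀ w, 0 < w → w < n → n ≤ n.choose w := by
  induction n with
  | zero => intro w _ h; omega
  | succ n ih =>
    intro w h0 h1
    obtain ⟨v, rfl⟩ : ∃ v, w = v + 1 := ⟨w - 1, by omega⟩
    rw [Nat.choose_succ_succ']
    by_cases h : v + 1 = n
    · subst h
      simp
    · have := ih (v + 1) (by omega) (by omega)
      have := Nat.choose_pos (n := n) (k := v) (by omega)
      omega

lemma wtB_rev {n : ℕ} (x : Fin n → Fin 2) : wtB (fun k => Fin.rev (x k)) = n - wtB x := by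
  rw [← wtB_zero]
  unfold wtB
  congr 1
  ext k
  simp only [Finset.mem_filter, Finset.mem_univ, true_and]
  generalize x k = j
  fin_cases j <;> simp

/-- unit phases with vanishing sum -/
lemma exists_phase (n : ℕ) (hn : 2 ≤ n) : ∃ ε : ℕ → ℂ, (∀ w, star (ε w) * ε w = 1) ∧
    ∑ x : Fin n → Fin 2, ε (wtB x) = 0 := by
  let S1 := Finset.univ.filter (fun x : Fin n → Fin 2 => 2 * wtB x < n)
  let S2 := Finset.univ.filter (fun x : Fin n → Fin 2 => n < 2 * wtB x)
  let S3 := Finset.univ.filter (fun x : Fin n → Fin 2 => 2 * wtB x = n)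
  have h12 : S1.card = S2.card := by
    refine Finset.card_bij (fun x _ => fun k => Fin.rev (x k)) ?_ ?_ ?_
    · intro x hx
      simp only [S1, S2, Finset.mem_filter, Finset.mem_univ, true_and, wtB_rev] at hx ⊢
      omega
    · intro x _ y _ h
      ext k
      have := congrFun h k
      simpa using congrArg Fin.val (Fin.rev_injective this)
    · intro x hx
      refine ⟨fun k => Fin.rev (x k), ?_, ?_⟩
      · simp only [S1, S2, Finset.mem_filter, Finset.mem_univ, true_and, wtB_rev] at hx ⊢
        have := wtB_le x
        omega
      · ext k; simp
  have hsum : ∀ f : (Fin n → Fin 2) → ℂ, ∑ x, f x = ∑ x ∈ S1, f x + ∑ x ∈ S2, f x + ∑ x ∈ S3, f x := by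
    intro f
    simp only [S1, S2, S3, Finset.sum_filter]
    rw [← Finset.sum_add_distrib, ← Finset.sum_add_distrib]
    refine Finset.sum_congr rfl fun x _ => ?_
    rcases lt_trichotomy (2 * wtB x) n with h | h | h
    · simp [h, h.ne, h.not_gt]
    · simp [h]
    · simp [h, h.ne', h.not_gt]
  have hcard : S1.card + S2.card + S3.card = 2 ^ n := by
    have := hsum (fun _ => 1)
    simp only [Finset.sum_const, nsmul_eq_mul, mul_one] at this
    have h' : (Finset.univ : Finset (Fin n → Fin 2)).card = 2 ^ n := by simp
    rw [h'] at this
    exact_mod_cast this.symm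
  have h3 : S3.card ≤ 2 ^ (n - 1) := by
    have : S3 ⊆ Finset.univ.filter (fun x : Fin n → Fin 2 => wtB x = n / 2) := by
      intro x hx
      simp only [S3, Finset.mem_filter, Finset.mem_univ, true_and] at hx ⊢
      omega
    refine (Finset.card_le_card this).trans ?_
    rw [card_wtB]
    have := Nat.choose_succ_le_two_pow (n - 1) (n / 2)
    rwa [Nat.sub_add_cancel (by omega)] at this
  have hpow : 2 ^ n = 2 * 2 ^ (n - 1) := by
    rw [← pow_succ', Nat.sub_add_cancel (by omega)]
  have hpos : 0 < 2 ^ (n - 1) := by positivity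
  have h1pos : 0 < S1.card := by omega
  have h31 : S3.card ≤ 2 * S1.card := by omega
  have h1r : (0 : ℝ) < S1.card := by exact_mod_cast h1pos
  have h31r : (S3.card : ℝ) ≤ 2 * S1.card := by exact_mod_cast h31
  let t : ℝ := (S3.card : ℝ) / (2 * S1.card)
  have ht0 : 0 ≤ t := by positivity
  have ht1 : t ≤ 1 := by
    rw [div_le_one (by positivity)]; exact h31r
  have htm : t * (2 * S1.card) = S3.card := by
    simp only [t]; field_simp
  let y : ℝ := Real.sqrt (1 - t ^ 2)
  have hy : y * y = 1 - t ^ 2 := Real.mul_self_sqrt (by nlinarith)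
  let z : ℂ := ⟨-t, y⟩
  have hz : star z * z = 1 := by
    apply Complex.ext
    · simp [z]; nlinarith
    · simp [z]; ring
  have hzz : z + star z = -2 * (t : ℂ) := by
    apply Complex.ext
    · simp [z]; ring
    · simp [z]
  refine ⟨fun w => if 2 * w < n then z else if n < 2 * w then star z else 1, ?_, ?_⟩
  · intro w
    dsimp only
    split_ifs
    · exact hz
    · rw [star_star, mul_comm]; exact hz
    · simp
  · rw [hsum]
    rw [Finset.sum_congr (s₁ := S1) rfl (g := fun _ => z), Finset.sum_congr (s₁ := S2) rfl (g := fun _ => star z),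
      Finset.sum_congr (s₁ := S3) rfl (g := fun _ => 1)]
    · simp only [Finset.sum_const, nsmul_eq_mul, ← h12]
      have : (t : ℂ) * (2 * S1.card) = S3.card := by exact_mod_cast htm
      linear_combination (S1.card : ℂ) * hzz - this
    · intro x hx
      simp only [S3, Finset.mem_filter, Finset.mem_univ, true_and] at hx
      simp [hx]
    · intro x hx
      simp only [S2, Finset.mem_filter, Finset.mem_univ, true_and] at hx
      simp [hx, hx.not_gt]
    · intro x hx
      simp only [S1, Finset.mem_filter, Finset.mem_univ, true_and] at hx
      simp [hx]

def sgB (i j : Fin 2) : ℝ := if i = 0 then 1 else if j = 0 then 1 else -1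

lemma q_bound (α β : ℝ) (hβ : 0 < β) (hβα : β < α) (n w : ℕ) (hw : w ≤ n) :
    (α ^ (n - w) * β ^ w) ^ 2 + (β ^ (n - w) * α ^ w) ^ 2 ≤ α ^ (2 * n) + β ^ (2 * n) ∧
    2 * (α ^ n * β ^ n) ≤ (α ^ (n - w) * β ^ w) ^ 2 + (β ^ (n - w) * α ^ w) ^ 2 := by
  obtain ⟨v, rfl⟩ : ∃ v, n = v + w := ⟨n - w, by omega⟩
  rw [Nat.add_sub_cancel]
  have e1 : β ^ v ≤ α ^ v := pow_le_pow_left₀ hβ.le hβα.le v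
  have e2 : β ^ w ≤ α ^ w := pow_le_pow_left₀ hβ.le hβα.le w
  have p1 : 0 < β ^ v := by positivity
  have p2 : 0 < β ^ w := by positivity
  have e3 : (β ^ v) ^ 2 ≤ (α ^ v) ^ 2 := pow_le_pow_left₀ p1.le e1 2
  have e4 : (β ^ w) ^ 2 ≤ (α ^ w) ^ 2 := pow_le_pow_left₀ p2.le e2 2
  simp only [pow_mul', pow_add]
  generalize α ^ v = a at *
  generalize α ^ w = b at *
  generalize β ^ v = c at *
  generalize β ^ w = d at *
  constructor
  · nlinarith [mul_nonneg (sub_nonneg.2 e3) (sub_nonneg.2 e4)]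
  · nlinarith [sq_nonneg (a * d - c * b)]

/-- For the cq-graph of two pure states and `n ≥ 2` with `αⁿ - βⁿ ≤ √((n-1)/n)`,
the `n`-fold product has `Υ_n ≥ 1/(α^{2n} + β^{2n})`. -/
theorem two_pure_states_upsilon_pow (α β : ℝ) (hβ : 0 < β) (hβα : β < α)
    (hnorm : α ^ 2 + β ^ 2 = 1) (n : ℕ) (hn : 2 ≤ n)
    (hcond : α ^ n - β ^ n ≤ Real.sqrt (((n : ℝ) - 1) / n)) :
    UpsilonCQ (powCQ
        (![!![((α : ℂ) ^ 2), (α : ℂ) * (β : ℂ); (α : ℂ) * (β : ℂ), ((β : ℂ) ^ 2)],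
           !![((α : ℂ) ^ 2), -((α : ℂ) * (β : ℂ));
              -((α : ℂ) * (β : ℂ)), ((β : ℂ) ^ 2)]]) n) ≥
      1 / (α ^ (2 * n) + β ^ (2 * n)) := by
  have hα : 0 < α := hβ.trans hβα
  obtain ⟨ε, hε, hεs⟩ := exists_phase n hn
  set lam : ℝ := α ^ (2 * n) + β ^ (2 * n) with hlam
  have hlam0 : 0 < lam := by positivity
  have hnR : (2 : ℝ) ≤ n := by exact_mod_cast hn
  let ψ : (Fin n → Fin 2) → ℝ := fun x => α ^ (n - wtB x) * β ^ (wtB x)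
  let r : (Fin n → Fin 2) → ℝ := fun x => β ^ (n - wtB x) * α ^ (wtB x)
  let u : (Fin n → Fin 2) → ℂ := fun x => ε (wtB x) * (r x : ℂ)
  let m : (Fin n → Fin 2) → ℝ := fun x =>
    ((Finset.univ.filter (fun y : Fin n → Fin 2 => wtB y = wtB x)).card : ℝ)
  let q : (Fin n → Fin 2) → ℝ := fun x => lam - ψ x ^ 2 - r x ^ 2
  let c : (Fin n → Fin 2) → ℝ := fun x => q x / (1 - 1 / m x)
  have hrψ : ∀ x, ψ x * r x = α ^ n * β ^ n := by
    intro x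
    obtain ⟨v, hv⟩ : ∃ v, n = v + wtB x := ⟨n - wtB x, by have := wtB_le x; omega⟩
    have e : n - wtB x = v := by omega
    have e1 : α ^ n = α ^ v * α ^ wtB x := by rw [← pow_add, ← hv]
    have e2 : β ^ n = β ^ v * β ^ wtB x := by rw [← pow_add, ← hv]
    simp only [ψ, r, e, e1, e2]
    ring
  have hψ1 : ∑ x, ψ x ^ 2 = 1 := sum_wtB n α β hnorm
  have hr1 : ∑ x, r x ^ 2 = 1 := sum_wtB n β α (by linarith)
  have hq0 : ∀ x, 0 ≤ q x := by
    intro x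
    have := (q_bound α β hβ hβα n (wtB x) (wtB_le x)).1
    simp only [q, ψ, r]
    linarith
  have hsq : (α ^ n - β ^ n) ^ 2 ≤ 1 - 1 / (n : ℝ) := by
    have h0 : 0 ≤ α ^ n - β ^ n := sub_nonneg.2 (pow_le_pow_left₀ hβ.le hβα.le n)
    have h1 : (0 : ℝ) ≤ ((n : ℝ) - 1) / n := div_nonneg (by linarith) (by linarith)
    have := pow_le_pow_left₀ h0 hcond 2
    rw [Real.sq_sqrt h1] at this
    have e : ((n : ℝ) - 1) / n = 1 - 1 / n := by field_simp
    linarith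
  have hq1 : ∀ x, q x ≤ 1 - 1 / (n : ℝ) := by
    intro x
    have := (q_bound α β hβ hβα n (wtB x) (wtB_le x)).2
    have e : (α ^ n - β ^ n) ^ 2 = lam - 2 * (α ^ n * β ^ n) := by
      rw [hlam, pow_mul', pow_mul']; ring
    simp only [q, ψ, r]
    linarith
  have key : ∀ x, q x = 0 ∨ (n : ℝ) ≤ m x := by
    intro x
    by_cases h0 : wtB x = 0
    · left
      simp only [q, ψ, r, h0, hlam, pow_mul']
      simp
    · by_cases h1 : wtB x = n
      · left
        simp only [q, ψ, r, h1, hlam, pow_mul']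
        simp
      · right
        simp only [m, card_wtB]
        exact_mod_cast choose_ge_self n (wtB x) (by omega) (by have := wtB_le x; omega)
  have key2 : ∀ x, 0 ≤ c x ∧ c x ≤ 1 ∧ c x * (1 - 1 / m x) = q x := by
    intro x
    rcases key x with h | h
    · simp [c, h]
    · have hm : 1 / m x ≤ 1 / n := one_div_le_one_div_of_le (by linarith) h
      have hn2 : 1 / (n : ℝ) ≤ 1 / 2 := one_div_le_one_div_of_le (by norm_num) hnR
      have hp : 0 < 1 - 1 / m x := by linarith
      refine ⟨div_nonneg (hq0 x) hp.le, ?_, ?_⟩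
      · rw [div_le_one hp]
        linarith [hq1 x]
      · exact div_mul_cancel₀ _ hp.ne'
  obtain ⟨T, hT, hT1, hTd⟩ := exT wtB ψ u c
    (fun x y h => by simp only [ψ, h]) (fun x y h => by simp only [u, r, h])
    (fun x y h => by simp only [c, q, ψ, r, m, h])
    (fun x => (key2 x).1) (fun x => (key2 x).2.1) hψ1
    (by
      have : ∀ x, star (u x) * u x = ((r x ^ 2 : ℝ) : ℂ) := by
        intro x
        simp only [u, star_mul']
        have h1 : star (r x : ℂ) = r x := Complex.conj_ofReal _
        rw [h1]
        push_cast
        linear_combination (r x : ℂ) ^ 2 * hε (wtB x)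
      simp only [this]
      rw [← Complex.ofReal_sum, hr1, Complex.ofReal_one])
    (by
      have : ∀ x, (ψ x : ℂ) * u x = ((α ^ n * β ^ n : ℝ) : ℂ) * ε (wtB x) := by
        intro x
        rw [← hrψ x]
        simp only [u]
        push_cast
        ring
      simp only [this]
      rw [← Finset.mul_sum, hεs, mul_zero])
  refine ups_ge _ (fun i x => ∏ k, sgB (i k) (x k)) ψ lam hlam0 ?_ ?_ ?_ hψ1 T hT hT1 ?_
  · intro i x
    rw [← Finset.prod_mul_distrib]
    refine Finset.prod_eq_one fun k _ => ?_
    unfold sgB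
    split_ifs <;> norm_num
  · intro x y
    simp only [← Finset.prod_mul_distrib]
    rw [← Fintype.prod_sum (fun (k : Fin n) (j : Fin 2) => sgB j (x k) * sgB j (y k))]
    by_cases h : x = y
    · subst h
      rw [if_pos rfl]
      have : ∀ k, ∑ j, sgB j (x k) * sgB j (x k) = 2 := by
        intro k
        rw [Fin.sum_univ_two]
        unfold sgB
        split_ifs <;> norm_num
      simp [this]
    · rw [if_neg h]
      obtain ⟨k, hk⟩ := Function.ne_iff.1 h
      refine Finset.prod_eq_zero (Finset.mem_univ k) ?_
      rw [Fin.sum_univ_two]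
      revert hk
      generalize x k = a
      generalize y k = b
      intro hk
      fin_cases a <;> fin_cases b <;> simp_all [sgB]
  · intro i x y
    simp only [ψ, ← prod_wtB, ← Finset.prod_mul_distrib, powCQ, Matrix.of_apply]
    push_cast
    rw [← Finset.prod_mul_distrib]
    refine Finset.prod_congr rfl fun k _ => ?_
    generalize i k = a
    generalize x k = b
    generalize y k = d
    fin_cases a <;> fin_cases b <;> fin_cases d <;> simp [sgB] <;> ring
  · intro x
    rw [hTd]
    have h1 : u x * star (u x) = ((r x ^ 2 : ℝ) : ℂ) := by
      simp only [u, star_mul']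
      have h1 : star (r x : ℂ) = r x := Complex.conj_ofReal _
      rw [h1]
      push_cast
      linear_combination (r x : ℂ) ^ 2 * hε (wtB x)
    have h2 := (key2 x).2.2
    have h3 : (c x : ℂ) * (1 - 1 / (m x : ℂ)) = (q x : ℂ) := by exact_mod_cast h2
    rw [h1]
    simp only [m, Complex.ofReal_natCast] at h3
    rw [h3]
    simp only [q]
    push_cast
    ring
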